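/- arXiv:1303.0852 — 7 statements merged into one kernel-verified Lean document; each statement's English description precedes it below -/
import Mathlib

section
/- Let A, B, C be groups and let ι_A : C → A and ι_B : C → B be injective group homomorphisms, neither of which is surjective. Then every element of the center of the amalgamated free product A *_C B lies in the image of C under the canonical homomorphism C → A *_C B. (Lemma 2.1(1) of the paper.) -/
namespace Monoid.PushoutI

variable {ι H : Type*} {G : ι → Type*} [∀ i, Group (G i)] [Group H] {φ : ∀ i, H →* G i}

variable (φ) in
/-- A list of letters is reduced if no letter lies in the base group and consecutive letters come
from different groups of the diagram. -/
structure IsReducedList (l : List (Σ i, G i)) : Prop where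
  notMem_range : ∀ g ∈ l, g.2 ∉ (φ g.1).range
  isChain : l.IsChain fun g g' => g.1 ≠ g'.1

variable (φ) in
/-- The product in the pushout of a list of letters. -/
def listProd (l : List (Σ i, G i)) : PushoutI φ :=
  (l.map fun g => of g.1 g.2).prod

@[simp]
theorem listProd_cons (g : Σ i, G i) (l : List (Σ i, G i)) :
    listProd φ (g :: l) = of g.1 g.2 * listProd φ l := by
  simp [listProd]

@[simp]
theorem listProd_append (l l' : List (Σ i, G i)) :
    listProd φ (l ++ l') = listProd φ l * listProd φ l' := by
  simp [listProd]

@[simp]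
theorem listProd_nil : listProd φ [] = 1 := rfl

theorem ofCoprodI_word_prod (w : CoprodI.Word G) :
    (ofCoprodI w.prod : PushoutI φ) = listProd φ w.toList := by
  simp [CoprodI.Word.prod, listProd, map_list_prod, Function.comp_def]

/-- The sequence of groups visited by a reduced list is determined by its product. -/
theorem IsReducedList.map_fst_eq (hφ : ∀ i, Function.Injective (φ i)) {l l' : List (Σ i, G i)}
    (hl : IsReducedList φ l) (hl' : IsReducedList φ l') (h : listProd φ l = listProd φ l') :
    l.map Sigma.fst = l'.map Sigma.fst := by
  obtain ⟨d⟩ := NormalWord.transversal_nonempty φ hφ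
  have key : ∀ {l : List (Σ i, G i)}, IsReducedList φ l → ∃ w : NormalWord d,
      w.prod = listProd φ l ∧ w.toList.map Sigma.fst = l.map Sigma.fst := by
    intro l hl
    let w : CoprodI.Word G :=
      ⟨l, fun g hg h1 => hl.notMem_range g hg (h1 ▸ one_mem _), hl.isChain⟩
    have hw : Reduced φ w := hl.notMem_range
    simpa [ofCoprodI_word_prod, w] using hw.exists_normalWord_prod_eq d
  obtain ⟨w, hw, hwl⟩ := key hl
  obtain ⟨w', hw', hwl'⟩ := key hl'
  have hww' : w = w' := NormalWord.prod_injective (by rw [hw, hw', h])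
  rw [← hwl, ← hwl', hww']

/-- An element outside the base group is the product of a nonempty reduced list. -/
theorem exists_isReducedList_cons (hφ : ∀ i, Function.Injective (φ i)) {x : PushoutI φ}
    (hx : x ∉ (base φ).range) :
    ∃ a l, IsReducedList φ (a :: l) ∧ listProd φ (a :: l) = x := by
  classical
  obtain ⟨d⟩ := NormalWord.transversal_nonempty φ hφ
  obtain ⟨w, rfl⟩ := (NormalWord.equiv (d := d)).symm.surjective x
  replace hx : w.prod ∉ (base φ).range := hx
  change ∃ a l, _ ∧ _ = w.prod
  have hnot : ∀ g ∈ w.toList, g.2 ∉ (φ g.1).range := fun g hg hr =>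
    w.ne_one g hg <| by
      rw [← (Subgroup.IsComplement.equiv_snd_eq_self_iff_mem (d.compl g.1) (one_mem _)).2
        (w.normalized g.1 g.2 hg)]
      exact (Subgroup.IsComplement.coe_equiv_snd_eq_one_iff_mem _ (d.one_mem _)).2 hr
  have hchain := w.chain_ne
  rw [NormalWord.prod, ofCoprodI_word_prod] at hx ⊢
  cases hl : w.toList with
  | nil => exact absurd ⟨w.head, by simp [hl]⟩ hx
  | cons a l =>
    rw [hl] at hnot hchain
    refine ⟨⟨a.1, φ a.1 w.head * a.2⟩, l, ⟨?_, ?_⟩, ?_⟩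
    · intro g hg
      rcases List.mem_cons.1 hg with rfl | hg
      · exact mt (Subgroup.mul_mem_cancel_left (φ a.1).range ⟨w.head, rfl⟩).1
          (hnot a List.mem_cons_self)
      · exact hnot g (List.mem_cons_of_mem _ hg)
    · simpa [List.isChain_cons] using hchain
    · simp [of_apply_eq_base, mul_assoc]

/-- If at least two groups are amalgamated, and the base group is proper in each of them, then the
center of the amalgamated product is contained in the base group. -/
theorem center_le_range_base [Nontrivial ι] (hφ : ∀ i, Function.Injective (φ i))
    (hφ' : ∀ i, ¬ Function.Surjective (φ i)) :
    Subgroup.center (PushoutI φ) ≤ (base φ).range := by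
  intro x hx
  by_contra hxr
  obtain ⟨a, l, hl, rfl⟩ := exists_isReducedList_cons hφ hxr
  rw [Subgroup.mem_center_iff] at hx
  by_cases hlast : ∀ g ∈ (a :: l).getLast?, g.1 = a.1
  · obtain ⟨j, hj⟩ := exists_ne a.1
    obtain ⟨b, hb⟩ : ∃ b, b ∉ (φ j).range := by
      simpa [Function.Surjective] using hφ' j
    have hleft : IsReducedList φ (⟨j, b⟩ :: a :: l) :=
      ⟨List.forall_mem_cons.2 ⟨hb, hl.notMem_range⟩, List.isChain_cons_cons.2 ⟨hj, hl.isChain⟩⟩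
    have hright : IsReducedList φ (a :: l ++ [⟨j, b⟩]) := by
      refine ⟨List.forall_mem_append.2 ⟨hl.notMem_range, by simpa using hb⟩,
        List.isChain_append.2 ⟨hl.isChain, List.isChain_singleton _, fun g hg g' hg' => ?_⟩⟩
      obtain rfl : (⟨j, b⟩ : Σ i, G i) = g' := by simpa using hg'
      rw [hlast g hg]
      exact hj.symm
    have := hleft.map_fst_eq hφ hright <| by
      rw [listProd_cons, hx, listProd_append, listProd_cons ⟨j, b⟩, listProd_nil, mul_one]
    exact hj (List.cons.inj this).1
  · cases l with
    | nil => simp at hlast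
    | cons c l =>
      have hrot : IsReducedList φ (c :: l ++ [a]) := by
        refine ⟨fun g hg => hl.notMem_range g (by simpa [or_comm, or_assoc, or_left_comm] using hg),
          List.isChain_append.2 ⟨(List.isChain_cons_cons.1 hl.isChain).2,
            List.isChain_singleton _, fun g hg g' hg' h => hlast ?_⟩⟩
        obtain rfl : a = g' := by simpa using hg'
        intro k hk
        rw [List.getLast?_cons_cons] at hk
        rwa [Option.mem_unique hk hg]
      have := hl.map_fst_eq hφ hrot <| by
        have h := hx (of a.1 a.2)
        rw [listProd_cons, mul_assoc, mul_left_cancel_iff] at h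
        rw [listProd_append, listProd_cons a, h, listProd_cons a [], listProd_nil, mul_one]
      exact (List.isChain_cons_cons.1 hl.isChain).1 (List.cons.inj this).1

end Monoid.PushoutI


/-- **Lemma 2.1(1)**: If `A ≠ C ≠ B`, then the center of the amalgamated free product
`A *_C B` is contained in (the image of) `C`.  Here the amalgamated product is
formalized as `Monoid.PushoutI` over a two-element index type `Bool`, with
`G true = A` and `G false = B`. -/
theorem center_le_base_range_of_pushout
    {C : Type*} [Group C] {G : Bool → Type*} [∀ b, Group (G b)]
    (φ : ∀ b, C →* G b)
    (hinj : ∀ b, Function.Injective (φ b))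
    (hnsurj : ∀ b, ¬ Function.Surjective (φ b)) :
    ∀ x ∈ Subgroup.center (Monoid.PushoutI φ),
      x ∈ (Monoid.PushoutI.base φ).range :=
  Monoid.PushoutI.center_le_range_base hinj hnsurj
end

section
/- Let G be a group, let A and B be subgroups of G, and let φ : A ≃* B be an isomorphism. If x lies in the center of the HNN extension HNNExtension G A B φ, then either x lies in the image of A under the canonical inclusion of : G → HNNExtension G A B φ, or x has infinite order and A = ⊤ and B = ⊤ (i.e., both associated subgroups are all of G). (Lemma 2.1(2) of the paper.) -/
namespace HNNExtension

open NormalWord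

variable {G : Type*} [Group G] {A B : Subgroup G} {φ : A ≃* B}

theorem t_zpow_mul_of (u : ℤˣ) (a : toSubgroup A B u) :
    (t ^ (u : ℤ) * of (a : G) : HNNExtension G A B φ) =
      of (toSubgroupEquiv φ u a : G) * t ^ (u : ℤ) := by
  rcases Int.units_eq_one_or u with rfl | rfl
  · simpa using! t_mul_of a
  · simpa using! inv_t_mul_of a

/-- The homomorphism sending `G` to `1` and the stable letter to the generator of `ℤ`. -/
def exponentSum : HNNExtension G A B φ →* Multiplicative ℤ :=
  lift 1 (Multiplicative.ofAdd 1) (by simp)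

theorem exponentSum_of (g : G) : exponentSum (of g : HNNExtension G A B φ) = 1 := by
  simp [exponentSum]

theorem exponentSum_t : exponentSum (t : HNNExtension G A B φ) = Multiplicative.ofAdd 1 := by
  simp [exponentSum]

theorem exponentSum_list_prod {u : ℤˣ} {l : List (ℤˣ × G)} (hl : ∀ p ∈ l, p.1 = u) :
    (exponentSum (l.map fun p ↦ (t ^ (p.1 : ℤ) * of p.2 : HNNExtension G A B φ)).prod).toAdd =
      l.length * (u : ℤ) := by
  induction l with
  | nil => simp
  | cons p l ih =>
    simp only [List.mem_cons, forall_eq_or_imp] at hl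
    simp only [List.map_cons, List.prod_cons, map_mul, map_zpow, exponentSum_of, exponentSum_t,
      mul_one, toAdd_mul, toAdd_zpow, toAdd_ofAdd, ih hl.2, hl.1, List.length_cons]
    push_cast
    simp
    ring

theorem exists_reducedWord_prod_eq (x : HNNExtension G A B φ) :
    ∃ w : ReducedWord G A B, w.prod φ = x := by
  obtain ⟨d⟩ := TransversalPair.nonempty G A B
  exact ⟨((NormalWord.equiv φ d) x).toReducedWord, (NormalWord.equiv φ d).symm_apply_apply x⟩

theorem mem_of_t_mul_of_mul_inv_mem_range {g : G}
    (h : (t * of g * t⁻¹ : HNNExtension G A B φ) ∈ (of : G →* HNNExtension G A B φ).range) :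
    g ∈ A := by
  by_contra hg
  let w : ReducedWord G A B := ⟨1, [(1, g), (-1, 1)], by simp [hg]⟩
  have := ReducedWord.toList_eq_nil_of_mem_of_range φ w
    (by simpa [w, ReducedWord.prod, mul_assoc] using h)
  simp [w] at this

theorem eq_of_mem_of_append_singleton_eq_cons {α : Type*} {a : α} {l : List α}
    (h : l ++ [a] = a :: l) : ∀ b ∈ l, b = a := by
  induction l with
  | nil => simp
  | cons c l ih =>
    simp only [List.cons_append, List.cons.injEq] at h
    obtain ⟨rfl, h⟩ := h
    simpa using ih h

/-- Changing the group element in the last letter keeps a chain reduced. -/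
theorem isChain_append_singleton_congr {l : List (ℤˣ × G)} {u : ℤˣ} {g : G} (g' : G)
    (h : (l ++ [(u, g)]).IsChain (fun a b => a.2 ∈ toSubgroup A B a.1 → a.1 = b.1)) :
    (l ++ [(u, g')]).IsChain (fun a b => a.2 ∈ toSubgroup A B a.1 → a.1 = b.1) := by
  simp only [List.isChain_append] at h ⊢
  refine ⟨h.1, by simp, ?_⟩
  simpa using h.2.2

theorem exponentSum_pos_of_mem_center {x : HNNExtension G A B φ}
    (hx : x ∈ Subgroup.center (HNNExtension G A B φ))
    (hr : x ∉ (of : G →* HNNExtension G A B φ).range) :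
    ∃ u : ℤˣ, toSubgroup A B (-u) = ⊤ ∧ 0 < (exponentSum x).toAdd * (u : ℤ) := by
  have hconj (y : HNNExtension G A B φ) : y * x * y⁻¹ = x := by
    rw [Subgroup.mem_center_iff.1 hx y, mul_inv_cancel_right]
  obtain ⟨⟨h, l, hl⟩, rfl⟩ := exists_reducedWord_prod_eq x
  rcases List.eq_nil_or_concat' l with rfl | ⟨l, ⟨u, g⟩, rfl⟩
  · exact absurd ⟨h, by simp [ReducedWord.prod]⟩ hr
  have hl' := (List.isChain_append.1 hl).1
  have hrot := hconj (t ^ (u : ℤ) * of g)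
  have hchain : ((u, g * h) :: l).IsChain
      (fun a b => a.2 ∈ toSubgroup A B a.1 → a.1 = b.1) := by
    by_contra hn
    rw [List.isChain_cons] at hn
    cases l with
    | nil => simp at hn
    | cons p l =>
      obtain ⟨v, k⟩ := p
      simp only [List.head?_cons, Option.mem_def, Option.some.injEq, forall_eq', hl', and_true,
        Classical.not_imp] at hn
      obtain ⟨hmem, hne⟩ := hn
      obtain rfl : v = -u := by
        rw [← Int.units_ne_iff_eq_neg]; exact Ne.symm hne
      let w : ReducedWord G A B :=
        ⟨toSubgroupEquiv φ u ⟨g * h, hmem⟩ * k, l, (List.isChain_cons.1 hl').2⟩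
      have hw : w.prod φ = ReducedWord.prod φ ⟨h, ((-u, k) :: l) ++ [(u, g)], hl⟩ := by
        rw [← hrot]
        have := t_zpow_mul_of (φ := φ) u ⟨g * h, hmem⟩
        rw [← mul_inv_eq_iff_eq_mul] at this
        simp only [w, ReducedWord.prod, map_mul, ← this]
        simp [mul_assoc]
      have := congrArg List.length (ReducedWord.map_fst_eq_and_of_prod_eq φ hw).1
      simp [w] at this
      omega
  have hu : ∀ p ∈ l ++ [(u, g)], p.1 = u := by
    let w : ReducedWord G A B := ⟨1, (u, g * h) :: l, hchain⟩
    have hw : ReducedWord.prod φ ⟨h, l ++ [(u, g)], hl⟩ = w.prod φ := by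
      rw [← hrot]
      simp [w, ReducedWord.prod, mul_assoc]
    have := eq_of_mem_of_append_singleton_eq_cons
      (by simpa [w] using (ReducedWord.map_fst_eq_and_of_prod_eq φ hw).1)
    simp only [List.mem_append, List.mem_singleton]
    rintro p (hp | rfl)
    · exact this _ (List.mem_map_of_mem hp)
    · rfl
  refine ⟨u, ?_, ?_⟩
  · rw [Subgroup.eq_top_iff']
    intro k
    let k' := h * k * h⁻¹
    let w : ReducedWord G A B :=
      ⟨k' * h, l ++ [(u, g * k'⁻¹)], isChain_append_singleton_congr _ hl⟩
    have hw : ReducedWord.prod φ ⟨h, l ++ [(u, g)], hl⟩ = w.prod φ := by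
      rw [← hconj (of k')]
      simp [w, ReducedWord.prod, mul_assoc]
    have hhead := (ReducedWord.map_fst_eq_and_of_prod_eq φ hw).2 u (by
      cases l with
      | nil => simp
      | cons p l => simpa using hu p (by simp))
    simpa [w, k', mul_assoc] using hhead
  · rw [ReducedWord.prod, map_mul, exponentSum_of, one_mul, exponentSum_list_prod hu, mul_assoc,
      ← Units.val_mul, Int.units_mul_self]
    simp

end HNNExtension

/-- **Lemma 2.1(2)**: a central element of the HNN extension `HNNExtension G A B φ`
either lies in the image of `A` under the canonical inclusion `of : G →* HNNExtension G A B φ`,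
or it has infinite order and `A = ⊤` and `B = ⊤`. -/
theorem center_hnnExtension_mem_or
    {G : Type*} [Group G] (A B : Subgroup G) (φ : A ≃* B)
    (x : HNNExtension G A B φ) (hx : x ∈ Subgroup.center (HNNExtension G A B φ)) :
    x ∈ A.map (HNNExtension.of : G →* HNNExtension G A B φ) ∨
      (¬ IsOfFinOrder x ∧ A = ⊤ ∧ B = ⊤) := by
  by_cases hr : x ∈ (HNNExtension.of : G →* HNNExtension G A B φ).range
  · obtain ⟨g, rfl⟩ := hr
    refine Or.inl ⟨g, HNNExtension.mem_of_t_mul_of_mul_inv_mem_range (φ := φ) ⟨g, ?_⟩, rfl⟩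
    rw [Subgroup.mem_center_iff.1 hx, mul_inv_cancel_right]
  · right
    obtain ⟨u, hu, hpos⟩ := HNNExtension.exponentSum_pos_of_mem_center hx hr
    obtain ⟨v, hv, hneg⟩ := HNNExtension.exponentSum_pos_of_mem_center (inv_mem hx)
      (by rwa [inv_mem_iff])
    rw [map_inv, toAdd_inv] at hneg
    constructor
    · intro hfin
      have h1 := (HNNExtension.exponentSum.isOfFinOrder hfin)
      rw [isOfFinOrder_iff_eq_one] at h1
      simp [h1] at hpos
    · rcases Int.units_eq_one_or u with rfl | rfl <;> rcases Int.units_eq_one_or v with rfl | rfl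
      · simp at hpos hneg
        omega
      · exact ⟨by simpa using hv, hu⟩
      · exact ⟨by simpa using hu, hv⟩
      · simp at hpos hneg
        omega
end

section
/- Let G be a group, let A and B be subgroups of G, and let φ : A ≃* B be an isomorphism. If x is a central element of the HNN extension HNNExtension G A B φ that lies in the image of the canonical inclusion of : G → HNNExtension G A B φ, say x = of(g) for g ∈ G, then g ∈ A and φ fixes g, i.e., the element of B obtained by applying φ to g (viewed in A) is equal to g as an element of G. (Established in the proof of Lemma 2.1(2).) -/
/-- From the proof of Lemma 2.1(2): if a central element of the HNN extension
`HNNExtension G A B φ` lies in the image of the canonical inclusion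
`of : G →* HNNExtension G A B φ`, say it equals `of g`, then `g ∈ A` and
`φ` fixes `g`. -/
theorem center_hnnExtension_of_mem
    {G : Type*} [Group G] (A B : Subgroup G) (φ : A ≃* B) (g : G)
    (hx : (HNNExtension.of g : HNNExtension G A B φ) ∈
      Subgroup.center (HNNExtension G A B φ)) :
    ∃ hg : g ∈ A, ((φ ⟨g, hg⟩ : B) : G) = g := by
  have hcomm := Subgroup.mem_center_iff.1 hx
  have hg : g ∈ A := by
    let w₁ : HNNExtension.NormalWord.ReducedWord G A B :=
      ⟨1, [(-1, g)], List.isChain_singleton _⟩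
    let w₂ : HNNExtension.NormalWord.ReducedWord G A B :=
      ⟨g, [(-1, 1)], List.isChain_singleton _⟩
    have hprod : w₁.prod φ = w₂.prod φ := by
      simpa [w₁, w₂, HNNExtension.NormalWord.ReducedWord.prod] using hcomm HNNExtension.t⁻¹
    simpa [w₁, w₂] using
      (HNNExtension.ReducedWord.map_fst_eq_and_of_prod_eq φ hprod).2 (-1) (by simp [w₁])
  refine ⟨hg, HNNExtension.of_injective (φ := φ) ?_⟩
  rw [HNNExtension.equiv_eq_conj, hcomm HNNExtension.t, mul_inv_cancel_right]
end

section
/- Let G be a group and let φ be an automorphism of G, and consider the HNN extension of G over the whole group, HNNExtension G ⊤ ⊤ φ. If x is a central element of this HNN extension that does not lie in the image of the canonical inclusion of : G → HNNExtension G ⊤ ⊤ φ, then there exist a nonzero integer l and an element a ∈ G such that x = tˡ · of(a), φ(a) = a, the automorphism φˡ is the inner automorphism c ↦ a⁻¹·c·a of G, and moreover x has infinite order. (Established in the proof of Lemma 2.1(2).) -/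
/-- An automorphism `φ` of `G`, viewed as an isomorphism `⊤ ≃* ⊤` between the
top subgroups of `G`, as used to form the HNN extension of `G` over the whole
group. -/
def MulAut.toTopSubgroupEquiv {G : Type*} [Group G] (φ : MulAut G) :
    (⊤ : Subgroup G) ≃* (⊤ : Subgroup G) :=
  (Subgroup.topEquiv.trans (φ : G ≃* G)).trans Subgroup.topEquiv.symm

namespace HNNExtension

variable {G : Type*} [Group G] (φ : MulAut G)

theorem of_mulAut_apply (g : G) :
    (of (φ g) : HNNExtension G ⊤ ⊤ φ.toTopSubgroupEquiv) = t * of g * t⁻¹ :=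
  equiv_eq_conj (φ := φ.toTopSubgroupEquiv) ⟨g, Subgroup.mem_top g⟩

theorem of_mulAut_zpow_apply (n : ℤ) (g : G) :
    (of ((φ ^ n) g) : HNNExtension G ⊤ ⊤ φ.toTopSubgroupEquiv) = t ^ n * of g * (t ^ n)⁻¹ := by
  induction n generalizing g with
  | zero => simp
  | succ n ih => rw [zpow_add_one, MulAut.mul_apply, ih, of_mulAut_apply]; group
  | pred n ih =>
    have h : (of g : HNNExtension G ⊤ ⊤ φ.toTopSubgroupEquiv) = t * of (φ⁻¹ g) * t⁻¹ := by
      rw [← of_mulAut_apply, MulAut.apply_inv_self]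
    rw [zpow_sub_one, MulAut.mul_apply, ih, h]
    group

theorem exists_eq_t_zpow_mul_of (x : HNNExtension G ⊤ ⊤ φ.toTopSubgroupEquiv) :
    ∃ (l : ℤ) (a : G), x = t ^ l * of a := by
  induction x using induction_on with
  | of g => exact ⟨0, g, by simp⟩
  | t => exact ⟨1, 1, by simp⟩
  | mul x y hx hy =>
    obtain ⟨l, a, rfl⟩ := hx
    obtain ⟨m, b, rfl⟩ := hy
    refine ⟨l + m, (φ ^ (-m)) a * b, ?_⟩
    rw [map_mul, of_mulAut_zpow_apply]
    group
  | inv x hx =>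
    obtain ⟨l, a, rfl⟩ := hx
    refine ⟨-l, (φ ^ l) a⁻¹, ?_⟩
    rw [of_mulAut_zpow_apply, map_inv]
    group

/-- The exponent sum of the stable letter. -/
def tExponent {A B : Subgroup G} (ψ : A ≃* B) : HNNExtension G A B ψ →* Multiplicative ℤ :=
  lift 1 (Multiplicative.ofAdd 1) (by simp)

theorem tExponent_t_zpow_mul_of {A B : Subgroup G} (ψ : A ≃* B) (l : ℤ) (a : G) :
    tExponent ψ (t ^ l * of a) = Multiplicative.ofAdd l := by
  simp [tExponent, ← ofAdd_zsmul]

theorem not_isOfFinOrder_t_zpow_mul_of {A B : Subgroup G} (ψ : A ≃* B) {l : ℤ} (hl : l ≠ 0)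
    (a : G) : ¬ IsOfFinOrder (t ^ l * of a : HNNExtension G A B ψ) := by
  intro h
  have h' := (tExponent ψ).isOfFinOrder h
  rw [tExponent_t_zpow_mul_of, isOfFinOrder_iff_eq_one] at h'
  exact hl h'

end HNNExtension

/-- From the proof of Lemma 2.1(2): a central element `x` of the HNN extension
`HNNExtension G ⊤ ⊤ φ` (for an automorphism `φ` of `G`) which does not lie in the
image of the canonical inclusion `of : G →* HNNExtension G ⊤ ⊤ φ` is of the form
`x = t ^ l * of a` with `l ≠ 0`, `φ a = a`, the automorphism `φ ^ l` is the inner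
automorphism `c ↦ a⁻¹ * c * a`, and `x` has infinite order. -/
theorem center_hnnExtension_top_not_of_mem
    {G : Type*} [Group G] (φ : MulAut G)
    (x : HNNExtension G ⊤ ⊤ φ.toTopSubgroupEquiv)
    (hx : x ∈ Subgroup.center (HNNExtension G ⊤ ⊤ φ.toTopSubgroupEquiv))
    (hnot : x ∉ (HNNExtension.of : G →* HNNExtension G ⊤ ⊤ φ.toTopSubgroupEquiv).range) :
    ∃ (l : ℤ) (a : G), l ≠ 0 ∧
      x = HNNExtension.t ^ l * HNNExtension.of a ∧
      φ a = a ∧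
      (∀ c : G, (φ ^ l) c = a⁻¹ * c * a) ∧
      ¬ IsOfFinOrder x := by
  obtain ⟨l, a, rfl⟩ := HNNExtension.exists_eq_t_zpow_mul_of φ x
  have hl : l ≠ 0 := by
    rintro rfl
    exact hnot ⟨a, by simp⟩
  rw [Subgroup.mem_center_iff] at hx
  refine ⟨l, a, hl, rfl, ?_, fun c => ?_, HNNExtension.not_isOfFinOrder_t_zpow_mul_of _ hl a⟩
  · apply HNNExtension.of_injective (φ := φ.toTopSubgroupEquiv)
    have h := hx HNNExtension.t
    rw [← mul_assoc, mul_assoc _ _ HNNExtension.t, ← zpow_one_add, add_comm 1 l, zpow_add_one,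
      mul_assoc, mul_left_cancel_iff] at h
    rw [HNNExtension.of_mulAut_apply, h, mul_inv_cancel_right]
  · apply HNNExtension.of_injective (φ := φ.toTopSubgroupEquiv)
    have h := hx (HNNExtension.of (a⁻¹ * c * a))
    have h' : (HNNExtension.t ^ l * HNNExtension.of a) * HNNExtension.of (a⁻¹ * c * a) =
        HNNExtension.t ^ l * HNNExtension.of c *
          (HNNExtension.of a : HNNExtension G ⊤ ⊤ φ.toTopSubgroupEquiv) := by
      simp [mul_assoc]
    rw [h', ← mul_assoc, mul_left_inj] at h
    rw [HNNExtension.of_mulAut_zpow_apply, ← h, mul_inv_cancel_right]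
end

section
/- Let G be a group, let c ∈ G be an element of infinite order, let C = zpowers c be the infinite cyclic subgroup generated by c, let B be a subgroup of G, and let φ : C ≃* B be an isomorphism. If the center of the HNN extension HNNExtension G C B φ is not contained in the image of C under the canonical inclusion, then G = C (so G is infinite cyclic), B = G, and HNNExtension G C B φ is isomorphic either to ℤ × ℤ or to the Klein bottle group. (The HNN-extension case in the proof of Lemma 3.1(i): for a group that is not the fundamental group of a 2-torus or Klein bottle, the center is contained in the edge group of every reduced elementary Z-splitting.) -/
/-- The single relator `t * c * t⁻¹ * c` of the Klein bottle group, where the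
generator `c` is indexed by `false` and the generator `t` by `true`. -/
def kleinBottleRels : Set (FreeGroup Bool) :=
  {FreeGroup.of true * FreeGroup.of false * (FreeGroup.of true)⁻¹ * FreeGroup.of false}

/-- The Klein bottle group: the presented group on two generators `c`, `t` with
the single relation `t * c * t⁻¹ * c = 1`. -/
abbrev KleinBottleGroup : Type := PresentedGroup kleinBottleRels

namespace HNNExtension

variable {G : Type*} [Group G] {A B : Subgroup G} {φ : A ≃* B}

theorem ReducedWord.exists_prod_eq_mul_of (w : NormalWord.ReducedWord G A B)
    (hw : w.toList ≠ []) (g : G) :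
    ∃ w' : NormalWord.ReducedWord G A B, w'.prod φ = w.prod φ * of g ∧ w'.head = w.head := by
  rcases w with ⟨h, l, hl⟩
  obtain ⟨l, ⟨u, x⟩, rfl⟩ := (List.eq_nil_or_concat' l).resolve_left hw
  refine ⟨⟨h, l ++ [(u, x * g)], ?_⟩, ?_, rfl⟩
  · simpa [List.isChain_append] using hl
  · simp [NormalWord.ReducedWord.prod, mul_assoc]

theorem conj_pow_notMem_range {u : ℤˣ} {g : G} (hg : g ∉ toSubgroup A B u) (n : ℕ) :
    (t ^ (u : ℤ)) ^ (n + 1) * of g * ((t ^ (u : ℤ)) ^ (n + 1))⁻¹ ∉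
      (of.range : Subgroup (HNNExtension G A B φ)) := by
  intro hmem
  let l : List (ℤˣ × G) :=
    List.replicate n (u, 1) ++ (u, g) :: List.replicate (n + 1) (-u, 1)
  have hl : l.IsChain (fun a b => a.2 ∈ toSubgroup A B a.1 → a.1 = b.1) := by
    simp only [l, List.isChain_append]
    refine ⟨?_, ?_, ?_⟩
    · exact List.isChain_replicate_of_rel _ (by simp)
    · rw [List.replicate_succ, List.isChain_cons_cons, ← List.replicate_succ]
      exact ⟨fun h => absurd h hg, List.isChain_replicate_of_rel _ (by simp)⟩
    · intro a ha b hb _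
      have := List.mem_of_getLast? ha
      obtain rfl : (u, g) = b := by simpa using hb
      rw [List.eq_of_mem_replicate this]
  have := ReducedWord.toList_eq_nil_of_mem_of_range φ ⟨1, l, hl⟩ (by
    convert hmem using 1
    simp [NormalWord.ReducedWord.prod, l, List.prod_replicate, pow_succ, mul_assoc]
    rw [← mul_inv_rev, ← mul_inv_rev, pow_mul_comm'])
  simp [l] at this

theorem exists_eq_pow_mul_of_mul_inv_pow {u : ℤˣ} (hu : toSubgroup A B (-u) = ⊤)
    (x : HNNExtension G A B φ) :
    ∃ (i j : ℕ) (g : G), x = (t ^ (u : ℤ)) ^ i * of g * ((t ^ (u : ℤ)) ^ j)⁻¹ := by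
  set s : HNNExtension G A B φ := t ^ (u : ℤ) with hs
  have comm (g : G) : ∃ g' : G, of g * s = s * of g' := by
    have hg : g ∈ toSubgroup A B (-u) := hu ▸ Subgroup.mem_top g
    rcases Int.units_eq_one_or u with rfl | rfl
    · exact ⟨φ.symm ⟨g, hg⟩, by simpa [hs] using of_mul_t (φ := φ) ⟨g, hg⟩⟩
    · exact ⟨φ ⟨g, hg⟩, by simpa [hs] using of_mul_inv_t (φ := φ) ⟨g, hg⟩⟩
  have comm_pow (n : ℕ) (g : G) : ∃ g' : G, of g * s ^ n = s ^ n * of g' := by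
    induction n generalizing g with
    | zero => exact ⟨g, by simp⟩
    | succ n ih =>
      obtain ⟨g₁, h₁⟩ := ih g
      obtain ⟨g₂, h₂⟩ := comm g₁
      exact ⟨g₂, by rw [pow_succ, ← mul_assoc, h₁, mul_assoc, h₂, mul_assoc]⟩
  induction x using induction_on with
  | of g => exact ⟨0, 0, g, by simp⟩
  | t =>
    rcases Int.units_eq_one_or u with rfl | rfl
    · exact ⟨1, 0, 1, by simp [hs]⟩
    · exact ⟨0, 1, 1, by simp [hs]⟩
  | inv x ih =>
    obtain ⟨i, j, g, rfl⟩ := ih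
    exact ⟨j, i, g⁻¹, by simp [mul_assoc]⟩
  | mul x y hx hy =>
    obtain ⟨i, j, g, rfl⟩ := hx
    obtain ⟨k, l, h, rfl⟩ := hy
    rcases le_total j k with hjk | hjk
    · obtain ⟨m, rfl⟩ := Nat.exists_eq_add_of_le hjk
      obtain ⟨g', hg'⟩ := comm_pow m g
      refine ⟨i + m, l, g' * h, ?_⟩
      rw [pow_add s i, pow_add s j, map_mul]
      calc _ = s ^ i * (of g * s ^ m) * of h * (s ^ l)⁻¹ := by group
        _ = _ := by rw [hg']; group
    · obtain ⟨m, rfl⟩ := Nat.exists_eq_add_of_le hjk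
      obtain ⟨h', hh'⟩ := comm_pow m h⁻¹
      refine ⟨i, l + m, g * h'⁻¹, ?_⟩
      have e : (s ^ m)⁻¹ * of h = of h'⁻¹ * (s ^ m)⁻¹ := by
        rw [map_inv, ← mul_inv_rev, ← hh']
        simp
      rw [pow_add s l, pow_add s k, map_mul]
      calc _ = s ^ i * of g * ((s ^ m)⁻¹ * of h) * (s ^ l)⁻¹ := by group
        _ = _ := by rw [e]; group

theorem exists_toSubgroup_eq_top_of_mem_center {z : HNNExtension G A B φ}
    (hz : z ∈ Subgroup.center (HNNExtension G A B φ))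
    (hzG : z ∉ (of.range : Subgroup (HNNExtension G A B φ))) :
    ∃ u : ℤˣ, toSubgroup A B (-u) = ⊤ := by
  obtain ⟨d⟩ := NormalWord.TransversalPair.nonempty G A B
  obtain ⟨w, rfl⟩ := (NormalWord.equiv φ d).symm.surjective z
  change w.prod φ ∈ _ at hz
  change w.prod φ ∉ _ at hzG
  have hl : w.toList ≠ [] := fun h => hzG ⟨w.head, by simp [NormalWord.ReducedWord.prod, h]⟩
  obtain ⟨⟨u, x⟩, l, hul⟩ := List.exists_cons_of_ne_nil hl
  refine ⟨u, (Subgroup.eq_top_iff' _).2 fun g => ?_⟩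
  obtain ⟨w', hw', hhead⟩ :=
    ReducedWord.exists_prod_eq_mul_of (φ := φ) w.toReducedWord hl (w.head * g * w.head⁻¹)
  have key := (ReducedWord.map_fst_eq_and_of_prod_eq φ
    (w₁ := ((w.head * g * w.head⁻¹) • w : NormalWord d).toReducedWord) (w₂ := w') ?_).2 u
    (by simp [hul])
  · simpa [hhead, mul_assoc] using key
  · rw [hw', NormalWord.prod_group_smul]
    exact Subgroup.mem_center_iff.1 hz _

theorem eq_top_of_mem_center {z : HNNExtension G A B φ}
    (hz : z ∈ Subgroup.center (HNNExtension G A B φ))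
    (hzA : z ∉ A.map (of : G →* HNNExtension G A B φ)) : A = ⊤ ∧ B = ⊤ := by
  have hzG : z ∉ (of.range : Subgroup (HNNExtension G A B φ)) := by
    rintro ⟨g, rfl⟩
    refine conj_pow_notMem_range (φ := φ) (u := 1) (g := g) (fun hg => hzA ⟨g, hg, rfl⟩) 0 ⟨g, ?_⟩
    rw [Subgroup.mem_center_iff.1 hz]
    simp
  obtain ⟨u, hu⟩ := exists_toSubgroup_eq_top_of_mem_center hz hzG
  obtain ⟨i, j, g, hg⟩ := exists_eq_pow_mul_of_mul_inv_pow hu z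
  set s : HNNExtension G A B φ := t ^ (u : ℤ) with hs
  have comm := Subgroup.mem_center_iff.1 hz
  obtain ⟨k, hk⟩ : ∃ k : ℤ, s ^ k = z * (of g)⁻¹ := by
    refine ⟨i - j, ?_⟩
    have h1 : s ^ j * z = s ^ i * of g := by rw [comm, hg]; group
    rw [sub_eq_neg_add, zpow_add, zpow_neg, zpow_natCast, zpow_natCast, inv_mul_eq_iff_eq_mul,
      ← mul_assoc, h1, mul_inv_cancel_right]
  have hk0 : k ≠ 0 := by
    rintro rfl
    exact hzG ⟨g, (mul_inv_eq_one.1 (by simpa using hk.symm)).symm⟩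
  have hconj (x : HNNExtension G A B φ) (hx : x = s ^ k ∨ x = (s ^ k)⁻¹) (h : G) :
      x * of h * x⁻¹ ∈ (of.range : Subgroup (HNNExtension G A B φ)) := by
    rcases hx with rfl | rfl
    · refine ⟨g⁻¹ * h * g, ?_⟩
      rw [hk, ← comm]
      calc of (g⁻¹ * h * g) = (of g)⁻¹ * (of h * z) * z⁻¹ * of g := by simp [mul_assoc]
        _ = _ := by rw [comm]; group
    · refine ⟨g * h * g⁻¹, ?_⟩
      rw [hk]
      calc of (g * h * g⁻¹) = of g * z⁻¹ * (z * of h) * (of g)⁻¹ := by simp [mul_assoc]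
        _ = _ := by rw [← comm]; group
  obtain ⟨n, hn⟩ := Nat.exists_eq_succ_of_ne_zero (Int.natAbs_ne_zero.2 hk0)
  have htop (v : ℤˣ) : toSubgroup A B v = ⊤ := by
    refine (Subgroup.eq_top_iff' _).2 fun h => by_contra fun hh => ?_
    refine conj_pow_notMem_range (φ := φ) hh n (hconj _ ?_ h)
    have hkn : k = (n + 1 : ℕ) ∨ k = -(n + 1 : ℕ) := by omega
    rw [hs, ← zpow_natCast, ← zpow_mul, ← zpow_mul, ← zpow_neg]
    rcases hkn with rfl | rfl <;> rcases Int.units_eq_one_or u with rfl | rfl <;>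
      rcases Int.units_eq_one_or v with rfl | rfl <;> simp
  exact ⟨by simpa using htop 1, by simpa using htop (-1)⟩


theorem map_generator_eq_or_eq_inv {c : G} (hc : ¬ IsOfFinOrder c)
    (hC : Subgroup.zpowers c = ⊤) (hB : B = ⊤) (φ : Subgroup.zpowers c ≃* B) :
    (φ ⟨c, Subgroup.mem_zpowers c⟩ : G) = c ∨ (φ ⟨c, Subgroup.mem_zpowers c⟩ : G) = c⁻¹ := by
  set c' : Subgroup.zpowers c := ⟨c, Subgroup.mem_zpowers c⟩
  obtain ⟨n, hn⟩ : (φ c' : G) ∈ Subgroup.zpowers c := by simp [hC]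
  obtain ⟨m, hm⟩ := (φ.symm ⟨c, by simp [hB]⟩).2
  have hcm : (c' ^ m : Subgroup.zpowers c) = φ.symm ⟨c, by simp [hB]⟩ :=
    Subtype.ext hm
  have h1 : (φ c' : G) ^ m = c := by
    have := congrArg (fun x => (φ x : G)) hcm
    simpa using this
  rw [← hn] at h1 ⊢
  have h2 : n * m = 1 := injective_zpow_iff_not_isOfFinOrder.2 hc (by
    simpa [zpow_mul] using h1)
  rcases Int.eq_one_or_neg_one_of_mul_eq_one h2 with rfl | rfl <;> simp

theorem exists_hom_apply_generator {H : Type*} [Group H] {c : G} (hc : ¬ IsOfFinOrder c)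
    (hC : Subgroup.zpowers c = ⊤) (x : H) : ∃ f : G →* H, f c = x := by
  have hbij : Function.Bijective (zpowersHom G c) := by
    refine ⟨fun m n h => ?_, fun g => ?_⟩
    · exact injective_zpow_iff_not_isOfFinOrder.2 hc h
    · obtain ⟨n, hn⟩ : g ∈ Subgroup.zpowers c := by simp [hC]
      exact ⟨Multiplicative.ofAdd n, hn⟩
  let e := MulEquiv.ofBijective _ hbij
  refine ⟨(zpowersHom H x).comp e.symm.toMonoidHom, ?_⟩
  have : e.symm c = Multiplicative.ofAdd 1 := by
    rw [MulEquiv.symm_apply_eq]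
    simp [e]
  simp [this]

theorem hom_ext_of_zpowers_eq_top {M : Type*} [Monoid M] {c : G} (hC : Subgroup.zpowers c = ⊤)
    {f g : HNNExtension G A B φ →* M} (hof : f (of c) = g (of c)) (ht : f t = g t) : f = g := by
  refine hom_ext (MonoidHom.eq_of_eqOn_dense (s := {c}) ?_ (by simpa using hof)) ht
  rw [← Subgroup.zpowers_eq_closure, hC]

theorem exists_lift_of_zpowers {H : Type*} [Group H] {c : G} (hc : ¬ IsOfFinOrder c)
    (hC : Subgroup.zpowers c = ⊤) (φ : Subgroup.zpowers c ≃* B) {ε : ℤ}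
    (hφ : (φ ⟨c, Subgroup.mem_zpowers c⟩ : G) = c ^ ε) (x y : H) (hxy : y * x = x ^ ε * y) :
    ∃ F : HNNExtension G (Subgroup.zpowers c) B φ →* H, F (of c) = x ∧ F t = y := by
  obtain ⟨f, hf⟩ := exists_hom_apply_generator hc hC x
  have hf_semiconj (a : Subgroup.zpowers c) : y * f a = f (φ a) * y := by
    obtain ⟨-, n, rfl⟩ := a
    have hn : (⟨c ^ n, n, rfl⟩ : Subgroup.zpowers c) = ⟨c, Subgroup.mem_zpowers c⟩ ^ n := rfl
    have hxy' : SemiconjBy y x (x ^ ε) := hxy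
    simpa [hn, hφ, hf] using (hxy'.zpow_right n).eq
  exact ⟨lift f y hf_semiconj, by simp [hf], by simp⟩

theorem t_mul_of_generator {c : G} {φ : Subgroup.zpowers c ≃* B} {ε : ℤ}
    (hφ : (φ ⟨c, Subgroup.mem_zpowers c⟩ : G) = c ^ ε) :
    (t * of c : HNNExtension G (Subgroup.zpowers c) B φ) = of c ^ ε * t := by
  simpa [hφ] using t_mul_of (φ := φ) ⟨c, Subgroup.mem_zpowers c⟩

theorem nonempty_mulEquiv_int_prod_int {c : G} (hc : ¬ IsOfFinOrder c)
    (hC : Subgroup.zpowers c = ⊤) {φ : Subgroup.zpowers c ≃* B}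
    (hφ : (φ ⟨c, Subgroup.mem_zpowers c⟩ : G) = c) :
    Nonempty (HNNExtension G (Subgroup.zpowers c) B φ ≃* Multiplicative (ℤ × ℤ)) := by
  have hφ' : (φ ⟨c, Subgroup.mem_zpowers c⟩ : G) = c ^ (1 : ℤ) := by simpa using hφ
  obtain ⟨F, hFc, hFt⟩ := exists_lift_of_zpowers hc hC φ hφ'
    ((Multiplicative.ofAdd 1, 1) : Multiplicative ℤ × Multiplicative ℤ)
    (1, Multiplicative.ofAdd 1) (by simp)
  have hcomm : Commute (of c : HNNExtension G (Subgroup.zpowers c) B φ) t := by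
    simpa [commute_iff_eq] using (t_mul_of_generator hφ').symm
  let K : Multiplicative ℤ × Multiplicative ℤ →* HNNExtension G (Subgroup.zpowers c) B φ :=
    (zpowersHom _ (of c)).noncommCoprod (zpowersHom _ t) fun m n => hcomm.zpow_zpow _ _
  have hK (m n : Multiplicative ℤ) : K (m, n) = of c ^ m.toAdd * t ^ n.toAdd := rfl
  refine ⟨(F.toMulEquiv K ?_ ?_).trans (MulEquiv.prodMultiplicative ℤ ℤ).symm⟩
  · exact hom_ext_of_zpowers_eq_top hC (by simp [hFc, hK]) (by simp [hFt, hK])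
  · refine MonoidHom.ext fun ⟨m, n⟩ => ?_
    simp [hFc, hFt, hK, ← ofAdd_zsmul]

theorem nonempty_mulEquiv_kleinBottleGroup {c : G} (hc : ¬ IsOfFinOrder c)
    (hC : Subgroup.zpowers c = ⊤) {φ : Subgroup.zpowers c ≃* B}
    (hφ : (φ ⟨c, Subgroup.mem_zpowers c⟩ : G) = c⁻¹) :
    Nonempty (HNNExtension G (Subgroup.zpowers c) B φ ≃* KleinBottleGroup) := by
  have hφ' : (φ ⟨c, Subgroup.mem_zpowers c⟩ : G) = c ^ (-1 : ℤ) := by simpa using hφ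
  have hrel : (PresentedGroup.of true * PresentedGroup.of false * (PresentedGroup.of true)⁻¹ *
      PresentedGroup.of false : KleinBottleGroup) = 1 :=
    PresentedGroup.one_of_mem (rels := kleinBottleRels) rfl
  obtain ⟨F, hFc, hFt⟩ := exists_lift_of_zpowers hc hC φ hφ'
    (PresentedGroup.of false : KleinBottleGroup) (PresentedGroup.of true) (by
      rw [zpow_neg_one, ← mul_inv_eq_iff_eq_mul]
      exact eq_inv_of_mul_eq_one_left hrel)
  have hK : ∀ r ∈ kleinBottleRels, FreeGroup.lift
      (fun b => if b then (t : HNNExtension G (Subgroup.zpowers c) B φ) else of c) r = 1 := by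
    rintro r rfl
    simp [t_mul_of_generator hφ']
  refine ⟨F.toMulEquiv (PresentedGroup.toGroup hK) ?_ ?_⟩
  · exact hom_ext_of_zpowers_eq_top hC (by simp [hFc]) (by simp [hFt])
  · refine PresentedGroup.ext fun b => ?_
    cases b <;> simp [hFc, hFt]

end HNNExtension

/-- The HNN-extension case in the proof of Lemma 3.1(i): let `c ∈ G` have
infinite order, let `C = zpowers c`, let `B ≤ G` and `φ : C ≃* B`.  If the center
of `HNNExtension G C B φ` is not contained in the image of `C` under the
canonical inclusion, then `G = C` (so `G` is infinite cyclic), `B = G`, and the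
HNN extension is isomorphic either to `ℤ × ℤ` or to the Klein bottle group. -/
theorem center_hnnExtension_zpowers_not_le
    {G : Type*} [Group G] (c : G) (hc : ¬ IsOfFinOrder c)
    (B : Subgroup G) (φ : Subgroup.zpowers c ≃* B)
    (h : ¬ Subgroup.center (HNNExtension G (Subgroup.zpowers c) B φ) ≤
      (Subgroup.zpowers c).map
        (HNNExtension.of : G →* HNNExtension G (Subgroup.zpowers c) B φ)) :
    Subgroup.zpowers c = ⊤ ∧ B = ⊤ ∧
      (Nonempty (HNNExtension G (Subgroup.zpowers c) B φ ≃* Multiplicative (ℤ × ℤ)) ∨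
        Nonempty (HNNExtension G (Subgroup.zpowers c) B φ ≃* KleinBottleGroup)) := by
  obtain ⟨z, hz, hzC⟩ := SetLike.not_le_iff_exists.1 h
  obtain ⟨hC, hB⟩ := HNNExtension.eq_top_of_mem_center hz hzC
  exact ⟨hC, hB, (HNNExtension.map_generator_eq_or_eq_inv hc hC hB φ).imp
    (HNNExtension.nonempty_mulEquiv_int_prod_int hc hC)
    (HNNExtension.nonempty_mulEquiv_kleinBottleGroup hc hC)⟩
end

section
/- Let φ be an automorphism of the infinite cyclic group Multiplicative ℤ. Then the HNN extension HNNExtension (Multiplicative ℤ) ⊤ ⊤ φ is isomorphic either to ℤ × ℤ (when φ is the identity) or to the Klein bottle group (when φ is inversion). (Used in the proof of Lemma 3.1(i): an HNN extension of an infinite cyclic group over itself is the fundamental group of a 2-torus or of a Klein bottle.) -/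
/-- An automorphism of the infinite cyclic group is the identity or the inversion. -/
theorem MulAut.eq_one_or_eq_inv_of_multiplicative_int (φ : MulAut (Multiplicative ℤ)) :
    φ = 1 ∨ φ = MulEquiv.inv (Multiplicative ℤ) := by
  rcases Int.addEquiv_eq_refl_or_neg (AddEquiv.toMultiplicative.symm φ) with h | h
  · left
    ext x
    exact DFunLike.congr_fun h x.toAdd
  · right
    ext x
    exact DFunLike.congr_fun h x.toAdd

namespace HNNExtension

theorem t_mul_of_top {G : Type*} [Group G] (φ : MulAut G) (g : G) :
    (t : HNNExtension G ⊤ ⊤ φ.toTopSubgroupEquiv) * of g = of (φ g) * t :=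
  t_mul_of (φ := φ.toTopSubgroupEquiv) ⟨g, Subgroup.mem_top g⟩

theorem commute_of_t (G : Type*) [Group G] (g : G) :
    Commute (of g : HNNExtension G ⊤ ⊤ (1 : MulAut G).toTopSubgroupEquiv) t := by
  simpa [Commute, SemiconjBy] using (t_mul_of_top 1 g).symm

/-- The HNN extension of `G` over the whole group along the identity is the direct product of `G`
with the infinite cyclic group generated by the stable letter. -/
def topOneEquivProd (G : Type*) [Group G] :
    HNNExtension G ⊤ ⊤ (1 : MulAut G).toTopSubgroupEquiv ≃* G × Multiplicative ℤ :=
  MonoidHom.toMulEquiv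
    (lift (MonoidHom.inl G (Multiplicative ℤ)) (1, Multiplicative.ofAdd 1) fun a => by
      simp [MulAut.toTopSubgroupEquiv])
    (MonoidHom.noncommCoprod of (zpowersHom _ t) fun g n => by
      simpa using (commute_of_t G g).zpow_right n.toAdd)
    (by ext <;> simp [MonoidHom.noncommCoprod_apply])
    (by ext <;> simp [MonoidHom.noncommCoprod_apply])

/-- The HNN extension of the infinite cyclic group over itself along the inversion is the
Klein bottle group. -/
def topInvEquivKleinBottleGroup :
    HNNExtension (Multiplicative ℤ) ⊤ ⊤
      (MulAut.toTopSubgroupEquiv (MulEquiv.inv (Multiplicative ℤ))) ≃* KleinBottleGroup :=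
  MonoidHom.toMulEquiv
    (lift (zpowersHom _ (PresentedGroup.of false)) (PresentedGroup.of true) fun a => by
      have h : SemiconjBy (PresentedGroup.of true : KleinBottleGroup)
          (PresentedGroup.of false) (PresentedGroup.of false)⁻¹ := by
        rw [SemiconjBy, ← mul_inv_eq_iff_eq_mul, eq_inv_iff_mul_eq_one]
        exact PresentedGroup.one_of_mem rfl
      simpa [MulAut.toTopSubgroupEquiv] using (h.zpow_right (a : Multiplicative ℤ).toAdd).eq)
    (PresentedGroup.toGroup
      (f := fun b => bif b then t else of (Multiplicative.ofAdd 1)) (by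
        rintro _ rfl
        simp [t_mul_of_top]))
    (by ext <;> simp)
    (by ext b; cases b <;> simp)

end HNNExtension

/-- Used in the proof of Lemma 3.1(i): an HNN extension of the infinite cyclic
group `Multiplicative ℤ` over the whole group is isomorphic either to `ℤ × ℤ`
(when the automorphism is the identity) or to the Klein bottle group (when it is
inversion). -/
theorem hnnExtension_multiplicative_int_top
    (φ : MulAut (Multiplicative ℤ)) :
    Nonempty (HNNExtension (Multiplicative ℤ) ⊤ ⊤ φ.toTopSubgroupEquiv ≃*
        Multiplicative (ℤ × ℤ)) ∨
      Nonempty (HNNExtension (Multiplicative ℤ) ⊤ ⊤ φ.toTopSubgroupEquiv ≃*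
        KleinBottleGroup) := by
  rcases φ.eq_one_or_eq_inv_of_multiplicative_int with rfl | rfl
  · exact .inl ⟨(HNNExtension.topOneEquivProd _).trans (MulEquiv.prodMultiplicative ℤ ℤ).symm⟩
  · exact .inr ⟨HNNExtension.topInvEquivKleinBottleGroup⟩
end

section
/- Let G be a finite group and let φ be an automorphism of G. Then the cyclic subgroup generated by the stable letter t in the HNN extension HNNExtension G ⊤ ⊤ φ has finite index in HNNExtension G ⊤ ⊤ φ. (Established in the proof of Lemma 4.2.) -/
namespace HNNExtension

variable {G : Type*} [Group G] (φ : MulAut G)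

theorem t_mul_of_toTopSubgroupEquiv (g : G) :
    (t : HNNExtension G ⊤ ⊤ φ.toTopSubgroupEquiv) * of g = of (φ g) * t :=
  t_mul_of (φ := φ.toTopSubgroupEquiv) ⟨g, Subgroup.mem_top g⟩

theorem t_zpow_mul_of_toTopSubgroupEquiv (n : ℤ) (g : G) :
    (t : HNNExtension G ⊤ ⊤ φ.toTopSubgroupEquiv) ^ n * of g = of ((φ ^ n) g) * t ^ n := by
  induction n generalizing g with
  | zero => simp
  | succ n ih =>
    rw [zpow_add_one, mul_assoc, t_mul_of_toTopSubgroupEquiv, ← mul_assoc, ih, mul_assoc,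
      zpow_add_one, MulAut.mul_apply]
  | pred n ih =>
    have h : (t : HNNExtension G ⊤ ⊤ φ.toTopSubgroupEquiv)⁻¹ * of g = of (φ⁻¹ g) * t⁻¹ := by
      rw [inv_mul_eq_iff_eq_mul, ← mul_assoc, t_mul_of_toTopSubgroupEquiv, MulAut.apply_inv_self,
        mul_inv_cancel_right]
    rw [zpow_sub_one, mul_assoc, h, ← mul_assoc, ih, mul_assoc, zpow_sub_one, MulAut.mul_apply]

theorem exists_eq_of_mul_t_zpow (x : HNNExtension G ⊤ ⊤ φ.toTopSubgroupEquiv) :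
    ∃ (g : G) (n : ℤ), x = of g * t ^ n := by
  induction x using induction_on with
  | of g => exact ⟨g, 0, by simp⟩
  | t => exact ⟨1, 1, by simp⟩
  | mul x y hx hy =>
    obtain ⟨g, m, rfl⟩ := hx
    obtain ⟨h, n, rfl⟩ := hy
    refine ⟨g * (φ ^ m) h, m + n, ?_⟩
    rw [mul_assoc, ← mul_assoc (t ^ m), t_zpow_mul_of_toTopSubgroupEquiv, map_mul, zpow_add]
    simp only [mul_assoc]
  | inv x hx =>
    obtain ⟨g, n, rfl⟩ := hx
    refine ⟨(φ ^ (-n)) g⁻¹, -n, ?_⟩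
    rw [← t_zpow_mul_of_toTopSubgroupEquiv, mul_inv_rev, zpow_neg, map_inv]

end HNNExtension

/-- Established in the proof of Lemma 4.2: for a finite group `G` and an
automorphism `φ` of `G`, the cyclic subgroup generated by the stable letter `t`
has finite index in the HNN extension `HNNExtension G ⊤ ⊤ φ`. -/
theorem zpowers_t_finiteIndex_of_finite
    {G : Type*} [Group G] [Finite G] (φ : MulAut G) :
    (Subgroup.zpowers
      (HNNExtension.t : HNNExtension G ⊤ ⊤ φ.toTopSubgroupEquiv)).FiniteIndex := by
  have hsurj : Function.Surjective fun g : G =>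
      (QuotientGroup.mk (HNNExtension.of g) : HNNExtension G ⊤ ⊤ φ.toTopSubgroupEquiv ⧸
        Subgroup.zpowers (HNNExtension.t : HNNExtension G ⊤ ⊤ φ.toTopSubgroupEquiv)) := by
    intro q
    obtain ⟨x, rfl⟩ := QuotientGroup.mk_surjective q
    obtain ⟨g, n, rfl⟩ := HNNExtension.exists_eq_of_mul_t_zpow φ x
    exact ⟨g, (QuotientGroup.mk_mul_of_mem _ (Subgroup.zpow_mem_zpowers _ n)).symm⟩
  have := Finite.of_surjective _ hsurj
  exact Subgroup.finiteIndex_of_finite_quotient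
end
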